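/- For a prime p, k ∈ {4,6,8,10,14}, and positive integers m, n, s, the Fourier coefficients satisfy a_k(m, n p^s) = p^{s(k-1)} (a_k(m p^s, n) - a_k(m p^{s-1}, n/p)) + a_k(m/p, n p^{s-1}), where terms with non-integer arguments are zero. -/

import Mathlib

open UpperHalfPlane Complex CongruenceSubgroup MatrixGroups
open scoped ModularForm Real MatrixGroups Manifold

noncomputable section

/-- `q = e^{2 π i τ}`. -/
def qexp (τ : UpperHalfPlane) : ℂ := Complex.exp (2 * π * Complex.I * τ)

/-- `f` has the `q`-expansion `∑ c n qⁿ` at `∞`, with only finitely many negative terms. -/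
def HasExpansion (f : UpperHalfPlane → ℂ) (c : ℤ → ℂ) : Prop :=
  (∃ N : ℤ, ∀ n : ℤ, n < N → c n = 0) ∧
    ∀ τ : UpperHalfPlane, HasSum (fun n : ℤ => c n * qexp τ ^ n) (f τ)

/-- Weakly holomorphic modular forms of weight `k` on `Γ`, together with their
Fourier coefficients. -/
structure WhmForm (Γ : Subgroup SL(2, ℤ)) (k : ℤ) where
  toFun : UpperHalfPlane → ℂ
  coeff : ℤ → ℂ
  holo : MDifferentiable 𝓘(ℂ) 𝓘(ℂ) toFun
  slash_eq : ∀ γ ∈ Γ, toFun ∣[k] γ = toFun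
  expansion : HasExpansion toFun coeff

/-- `f = q^{-m} + O(q^{ℓ+1})`. -/
def IsBasisElt {Γ : Subgroup SL(2, ℤ)} (k ℓ m : ℤ) (f : WhmForm Γ k) : Prop :=
  f.coeff (-m) = 1 ∧ ∀ n : ℤ, n ≠ -m → n ≤ ℓ → f.coeff n = 0

/-- multiplication of a point of the upper half plane by a positive real number. -/
def rscale (a : ℝ) (ha : 0 < a) (τ : UpperHalfPlane) : UpperHalfPlane :=
  ⟨a * τ, by simpa [Complex.mul_im] using mul_pos ha τ.2⟩

/-- `τ ↦ -1/τ` on the upper half plane. -/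
def neginv (τ : UpperHalfPlane) : UpperHalfPlane :=
  ⟨(-(τ : ℂ))⁻¹, τ.im_inv_neg_coe_pos⟩

/-- `a m n` is the integer Fourier coefficient `a_k(m,n)` of the canonical basis element
`f_{k,m} = q^{-m} + O(q)` (here `ℓ = 0`), with `a m n = 0` out of range. -/
def IsCoeffs (k : ℤ) (a : ℤ → ℤ → ℤ) : Prop :=
  (∀ m : ℤ, 0 ≤ m → ∃ f : WhmForm ⊤ k, IsBasisElt k 0 m f ∧
      ∀ n : ℤ, 0 < n → f.coeff n = (a m n : ℂ)) ∧
  ∀ m n : ℤ, m < 0 ∨ n ≤ 0 → a m n = 0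

section HeckeRecursion

variable {k : ℤ}

/-- The transformation law under `SL(2, ℤ)`, as a statement about functions on `ℂ`. -/
lemma apply_ofComplex_moebius {f : ℍ → ℂ} (hf : ∀ γ : SL(2, ℤ), f ∣[k] γ = f)
    {a b c d : ℤ} (h : a * d - b * c = 1) {z : ℂ} (hz : 0 < z.im) :
    f (ofComplex ((a * z + b) / (c * z + d))) = (c * z + d) ^ k * f (ofComplex z) := by
  let γ : SL(2, ℤ) := ⟨!![a, b; c, d], by rw [Matrix.det_fin_two_of, h]⟩
  have hsmul : γ • ofComplex z = ofComplex ((a * z + b) / (c * z + d)) := by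
    rw [← ofComplex_apply (γ • ofComplex z), coe_specialLinearGroup_apply,
      ofComplex_apply_of_im_pos hz]
    simp [γ]
  have hden : denom γ (ofComplex z) = c * z + d := by
    rw [ModularGroup.denom_apply, ofComplex_apply_of_im_pos hz]
    simp [γ]
  have hne : (c * z + d : ℂ) ≠ 0 := hden ▸ denom_ne_zero _ _
  have := congrFun (hf γ) (ofComplex z)
  rw [ModularForm.SL_slash_apply, hsmul, hden, zpow_neg] at this
  rw [← this, mul_left_comm, mul_inv_cancel₀ (zpow_ne_zero _ hne), mul_one]

lemma qexp_eq_qParam (τ : ℍ) : qexp τ = Function.Periodic.qParam 1 τ := by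
  simp [qexp, Function.Periodic.qParam]

lemma rank_cuspForm_eq_zero (hk : k < 12 ∨ k = 14) : Module.rank ℂ (CuspForm 𝒮ℒ k) = 0 := by
  rcases hk with hk | rfl
  · exact CuspForm.rank_eq_zero_of_weight_lt_twelve hk
  · exact CuspForm.discriminantEquiv.rank_eq.trans ModularForm.levelOne_weight_two_rank_zero

lemma coeff_eq_zero_of_vanishing (hk : k < 12 ∨ k = 14) {f : ℍ → ℂ} {c : ℤ → ℂ}
    (hhol : MDifferentiable 𝓘(ℂ) 𝓘(ℂ) f) (hslash : ∀ γ : SL(2, ℤ), f ∣[k] γ = f)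
    (hsum : ∀ τ : ℍ, HasSum (fun n : ℤ => c n * qexp τ ^ n) (f τ)) (hc : ∀ n ≤ 0, c n = 0)
    (n : ℤ) : c n = 0 := by
  have hsum' (τ : ℍ) : HasSum (fun n : ℕ ↦ c n • Function.Periodic.qParam 1 τ ^ n) (f τ) := by
    have hz : ∀ x ∉ Set.range (Nat.cast : ℕ → ℤ), c x * qexp τ ^ x = 0 := fun x hx ↦ by
      rw [hc x (le_of_not_ge fun h ↦ hx ⟨x.toNat, Int.toNat_of_nonneg h⟩), zero_mul]
    simpa [Function.comp_def, qexp_eq_qParam] using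
      (Nat.cast_injective.hasSum_iff hz).mpr (hsum τ)
  have hbdd : IsBoundedAtImInfty f := isBoundedAtImInfty_of_hasSum_qExpansion one_pos hsum'
  let F : ModularForm 𝒮ℒ k :=
    { toFun := f
      slash_action_eq' := fun A ⟨γ, hγ⟩ ↦ hγ ▸ hslash γ
      holo' := hhol
      bdd_at_cusps' := fun hc ↦ by
        rw [Subgroup.IsArithmetic.isCusp_iff_isCusp_SL2Z] at hc
        rw [OnePoint.isBoundedAt_iff_forall_SL2Z hc]
        intro γ _
        rw [hslash]
        exact hbdd }
  have hcoeff (n : ℕ) : c n = (qExpansion 1 F).coeff n :=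
    ModularFormClass.qExpansion_coeff_unique (f := F) one_pos one_mem_strictPeriods_SL hsum' n
  have h0 : (qExpansion 1 F).coeff 0 = 0 := by
    rw [← hcoeff]
    exact hc _ le_rfl
  have hF : (f : ℍ → ℂ) = 0 := by
    have := rank_zero_iff_forall_zero.mp (rank_cuspForm_eq_zero hk) (ModularForm.toCuspForm F h0)
    funext τ
    exact DFunLike.congr_fun this τ
  rcases le_or_gt n 0 with hn | hn
  · exact hc n hn
  · lift n to ℕ using hn.le
    rw [hcoeff, show (F : ℍ → ℂ) = 0 from hF, qExpansion_zero, map_zero]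

lemma sum_exp_zmod (p : ℕ) [NeZero p] (n : ℤ) :
    ∑ j : ZMod p, Complex.exp (2 * π * Complex.I * (n * j.val) / p) =
      if (p : ℤ) ∣ n then (p : ℂ) else 0 := by
  have := AddChar.sum_mulShift (n : ZMod p) (ZMod.isPrimitive_stdAddChar p)
  simp only [ZMod.intCast_zmod_eq_zero_iff_dvd, ZMod.card] at this
  push_cast at this
  rw [← this]
  refine Finset.sum_congr rfl fun j _ ↦ ?_
  have := ZMod.stdAddChar_coe (N := p) (n * j.val : ℤ)
  push_cast at this
  rw [ZMod.natCast_zmod_val, mul_comm (n : ZMod p)] at this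
  exact this.symm

/-- The Hecke operator `T_p` of weight `k` on functions on the upper half plane. -/
def heckeOperator (p : ℕ) [NeZero p] (k : ℤ) (f : ℍ → ℂ) (τ : ℍ) : ℂ :=
  (p : ℂ) ^ (k - 1) * f (ofComplex (p * τ)) +
    (p : ℂ)⁻¹ * ∑ j : ZMod p, f (ofComplex ((τ + j.val) / p))

lemma natCast_mul_im_pos (p : ℕ) [NeZero p] {z : ℂ} (hz : 0 < z.im) : 0 < (p * z : ℂ).im := by
  have : (0 : ℝ) < p := Nat.cast_pos.mpr (NeZero.pos p)
  simpa using mul_pos this hz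

lemma add_div_natCast_im_pos (p : ℕ) [NeZero p] (j : ℕ) {z : ℂ} (hz : 0 < z.im) :
    0 < ((z + j) / p : ℂ).im := by
  have : (0 : ℝ) < p := Nat.cast_pos.mpr (NeZero.pos p)
  simpa using div_pos hz this

lemma apply_add_div_eq_of_zmod_eq (p : ℕ) [NeZero p] {f : ℍ → ℂ}
    (hf : ∀ γ : SL(2, ℤ), f ∣[k] γ = f) {a b : ℕ} (h : (a : ZMod p) = b) {z : ℂ}
    (hz : 0 < z.im) : f (ofComplex ((z + a) / p)) = f (ofComplex ((z + b) / p)) := by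
  have hp : (p : ℂ) ≠ 0 := NeZero.ne _
  have h' : ((a : ℤ) : ZMod p) = (b : ℤ) := by exact_mod_cast h
  obtain ⟨t, ht⟩ := (ZMod.intCast_eq_intCast_iff_dvd_sub _ _ _).mp h'.symm
  have := apply_ofComplex_moebius hf (a := 1) (b := t) (c := 0) (d := 1) (by ring)
    (add_div_natCast_im_pos p b hz)
  have ht' : (a : ℂ) = b + p * t := by
    have : (a : ℤ) = b + p * t := by lia
    exact_mod_cast this
  simp only [Int.cast_one, one_mul, Int.cast_zero, zero_mul, zero_add, div_one, one_zpow] at this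
  rw [← this, ht']
  congr 2
  field_simp
  ring

lemma heckeOperator_slash_T (p : ℕ) [NeZero p] {f : ℍ → ℂ}
    (hf : ∀ γ : SL(2, ℤ), f ∣[k] γ = f) :
    heckeOperator p k f ∣[k] ModularGroup.T = heckeOperator p k f := by
  ext τ
  have h1 : f (ofComplex (p * (1 + τ : ℂ))) = f (ofComplex (p * τ)) := by
    have := apply_ofComplex_moebius hf (a := 1) (b := p) (c := 0) (d := 1) (by ring)
      (natCast_mul_im_pos p τ.im_pos)
    simp only [Int.cast_one, one_mul, Int.cast_zero, zero_mul, zero_add, div_one, one_zpow,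
      Int.cast_natCast] at this
    rw [← this]
    ring_nf
  have h2 : ∑ j : ZMod p, f (ofComplex ((1 + τ + j.val) / p)) =
      ∑ j : ZMod p, f (ofComplex ((τ + j.val) / p)) := by
    rw [← Equiv.sum_comp (Equiv.addLeft (1 : ZMod p))
      fun j : ZMod p ↦ f (ofComplex ((τ + j.val) / p))]
    refine Finset.sum_congr rfl fun j _ ↦ ?_
    rw [show (1 + τ + j.val : ℂ) = τ + (1 + j.val : ℕ) by push_cast; ring]
    exact apply_add_div_eq_of_zmod_eq p hf (by simp) τ.im_pos
  rw [ModularForm.SL_slash_apply, ModularGroup.denom_apply, modular_T_smul]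
  simp only [heckeOperator, coe_vadd, ofReal_one, h1, h2]
  simp [ModularGroup.T]

lemma apply_inv_add_div (p : ℕ) [Fact p.Prime] {f : ℍ → ℂ}
    (hf : ∀ γ : SL(2, ℤ), f ∣[k] γ = f) {j : ZMod p} (hj : j ≠ 0) {z : ℂ} (hz : 0 < z.im) :
    f (ofComplex ((-z⁻¹ + j.val) / p)) = z ^ k * f (ofComplex ((z + (-j⁻¹).val) / p)) := by
  have hp : (p : ℂ) ≠ 0 := NeZero.ne _
  have hz0 : z ≠ 0 := fun h ↦ by simp [h] at hz
  obtain ⟨t, ht⟩ : (p : ℤ) ∣ -(j.val * (-j⁻¹).val : ℤ) - 1 := by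
    rw [← ZMod.intCast_zmod_eq_zero_iff_dvd]
    push_cast
    simp [hj]
  generalize (-j⁻¹).val = e at *
  have := apply_ofComplex_moebius hf (a := j.val) (b := t) (c := p) (d := -e)
    (by lia) (add_div_natCast_im_pos p e hz)
  have ht' : (p * t : ℂ) = -(j.val * e) - 1 := by exact_mod_cast ht.symm
  push_cast at this
  rw [show (p * ((z + e) / p) + -e : ℂ) = z by field_simp; ring] at this
  rw [← this]
  congr 2
  field_simp
  linear_combination -ht'

lemma heckeOperator_slash_S (p : ℕ) [Fact p.Prime] {f : ℍ → ℂ}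
    (hf : ∀ γ : SL(2, ℤ), f ∣[k] γ = f) :
    heckeOperator p k f ∣[k] ModularGroup.S = heckeOperator p k f := by
  have hp : (p : ℂ) ≠ 0 := NeZero.ne _
  ext τ
  have hτ : (τ : ℂ) ≠ 0 := τ.ne_zero
  have hS {z : ℂ} (hz : 0 < z.im) : f (ofComplex (-z⁻¹)) = z ^ k * f (ofComplex z) := by
    have := apply_ofComplex_moebius hf (a := 0) (b := -1) (c := 1) (d := 0) (by ring) hz
    simpa [neg_div] using this
  have h1 : f (ofComplex (p * -(τ : ℂ)⁻¹)) = (τ / p) ^ k * f (ofComplex (τ / p)) := by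
    rw [← hS (by simpa using add_div_natCast_im_pos p 0 τ.im_pos)]
    congr 2
    field_simp
  have h2 : f (ofComplex (-(τ : ℂ)⁻¹ / p)) = (p * τ) ^ k * f (ofComplex (p * τ)) := by
    rw [← hS (natCast_mul_im_pos p τ.im_pos)]
    congr 2
    field_simp
  have hinv : Function.Involutive fun j : ZMod p ↦ -j⁻¹ := fun j ↦ by simp [inv_neg]
  have h3 : ∑ j : ZMod p, f (ofComplex ((-(τ : ℂ)⁻¹ + j.val) / p)) =
      (p * τ) ^ k * f (ofComplex (p * τ)) +
        τ ^ k * (∑ j : ZMod p, f (ofComplex ((τ + j.val) / p)) - f (ofComplex (τ / p))) := by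
    rw [← Equiv.sum_comp (hinv.toPerm _) fun j : ZMod p ↦ f (ofComplex ((τ + j.val) / p)),
      ← Finset.add_sum_erase _ _ (Finset.mem_univ (0 : ZMod p)),
      ← Finset.add_sum_erase _ (fun j ↦ f (ofComplex ((τ + (hinv.toPerm _ j).val) / p)))
        (Finset.mem_univ (0 : ZMod p))]
    simp only [ZMod.val_zero, Nat.cast_zero, add_zero, h2, Function.Involutive.coe_toPerm,
      inv_zero, neg_zero, add_sub_cancel_left, Finset.mul_sum]
    congr 1
    exact Finset.sum_congr rfl fun j hj ↦
      apply_inv_add_div p hf (Finset.ne_of_mem_erase hj) τ.im_pos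
  rw [ModularForm.SL_slash_apply, ModularGroup.denom_S, modular_S_smul]
  simp only [heckeOperator, inv_neg, h1, h3]
  rw [zpow_neg, ← div_eq_mul_inv, div_eq_iff (zpow_ne_zero _ hτ), zpow_sub_one₀ hp, div_zpow,
    mul_zpow]
  have := zpow_ne_zero k hp
  field_simp
  ring

lemma heckeOperator_slash (p : ℕ) [Fact p.Prime] {f : ℍ → ℂ}
    (hf : ∀ γ : SL(2, ℤ), f ∣[k] γ = f) (γ : SL(2, ℤ)) :
    heckeOperator p k f ∣[k] γ = heckeOperator p k f :=
  SlashInvariantForm.slash_action_generators_SL2Z (heckeOperator_slash_S p hf)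
    (heckeOperator_slash_T p hf) γ

lemma mdifferentiable_heckeOperator (p : ℕ) [NeZero p] {f : ℍ → ℂ}
    (hf : MDifferentiable 𝓘(ℂ) 𝓘(ℂ) f) :
    MDifferentiable 𝓘(ℂ) 𝓘(ℂ) (heckeOperator p k f) := by
  rw [UpperHalfPlane.mdifferentiable_iff] at hf ⊢
  have h1 : DifferentiableOn ℂ (fun z : ℂ ↦ f (ofComplex (p * z))) {z | 0 < z.im} :=
    hf.comp (g := f ∘ ofComplex) (by fun_prop) fun z hz ↦ natCast_mul_im_pos p hz
  have h2 (j : ZMod p) :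
      DifferentiableOn ℂ (fun z : ℂ ↦ f (ofComplex ((z + j.val) / p))) {z | 0 < z.im} :=
    hf.comp (g := f ∘ ofComplex) (by fun_prop) fun z hz ↦ add_div_natCast_im_pos p j.val hz
  refine ((h1.const_mul ((p : ℂ) ^ (k - 1))).add ((DifferentiableOn.fun_sum
    (u := Finset.univ) fun j _ ↦ h2 j).const_mul (p : ℂ)⁻¹)).congr fun z hz ↦ ?_
  simp [heckeOperator, ofComplex_apply_of_im_pos hz]

/-- The `n`-th Fourier coefficient of the image under `T_p` of a form with coefficients `c`. -/
def heckeCoeff (p : ℕ) (k : ℤ) (c : ℤ → ℂ) (n : ℤ) : ℂ :=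
  (p : ℂ) ^ (k - 1) * (if (p : ℤ) ∣ n then c (n / p) else 0) + c (n * p)

lemma hasSum_heckeOperator (p : ℕ) [NeZero p] {f : ℍ → ℂ} {c : ℤ → ℂ}
    (hf : ∀ τ : ℍ, HasSum (fun n : ℤ => c n * qexp τ ^ n) (f τ)) (τ : ℍ) :
    HasSum (fun n : ℤ => heckeCoeff p k c n * qexp τ ^ n) (heckeOperator p k f τ) := by
  have hp : (p : ℂ) ≠ 0 := NeZero.ne _
  have hp' : (p : ℤ) ≠ 0 := NeZero.ne _
  have hinj : Function.Injective fun n : ℤ ↦ n * p := mul_left_injective₀ hp'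
  have hrange {n : ℤ} (hn : n ∉ Set.range fun n : ℤ ↦ n * p) : ¬ (p : ℤ) ∣ n :=
    fun ⟨t, ht⟩ ↦ hn ⟨t, by rw [ht, mul_comm]⟩
  have h1 : HasSum (fun n : ℤ ↦ (if (p : ℤ) ∣ n then c (n / p) else 0) * qexp τ ^ n)
      (f (ofComplex (p * τ))) := by
    refine (hinj.hasSum_iff fun n hn ↦ by rw [if_neg (hrange hn), zero_mul]).mp ?_
    convert hf (ofComplex (p * τ)) using 2 with n
    rw [qexp, qexp, ofComplex_apply_of_im_pos (natCast_mul_im_pos p τ.im_pos),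
      Function.comp_apply, if_pos (dvd_mul_left _ _), Int.mul_ediv_cancel _ hp',
      ← Complex.exp_int_mul, ← Complex.exp_int_mul]
    push_cast
    ring_nf
  have h2 : HasSum (fun n : ℤ ↦ c (n * p) * qexp τ ^ n)
      ((p : ℂ)⁻¹ * ∑ j : ZMod p, f (ofComplex ((τ + j.val) / p))) := by
    have hsum := (hasSum_sum (s := Finset.univ) fun (j : ZMod p) _ ↦
      hf (ofComplex ((τ + j.val) / p))).mul_left (p : ℂ)⁻¹
    have hterm (n : ℤ) :
        (p : ℂ)⁻¹ * ∑ j : ZMod p, c n * qexp (ofComplex ((τ + j.val) / p)) ^ n =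
          if (p : ℤ) ∣ n then c n * Complex.exp (2 * π * Complex.I * (n * τ) / p) else 0 := by
      have (j : ZMod p) : c n * qexp (ofComplex ((τ + j.val) / p)) ^ n =
          c n * Complex.exp (2 * π * Complex.I * (n * τ) / p) *
            Complex.exp (2 * π * Complex.I * (n * j.val) / p) := by
        rw [qexp, ofComplex_apply_of_im_pos (add_div_natCast_im_pos p j.val τ.im_pos),
          ← Complex.exp_int_mul, mul_assoc (c n), ← Complex.exp_add]
        congr 2
        ring
      simp_rw [this, ← Finset.mul_sum, sum_exp_zmod]
      split_ifs
      · field_simp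
      · simp
    simp_rw [hterm] at hsum
    refine ((hinj.hasSum_iff fun n hn ↦ if_neg (hrange hn)).mpr hsum).congr_fun fun n ↦ ?_
    rw [Function.comp_apply, if_pos (dvd_mul_left _ _), qexp, ← Complex.exp_int_mul]
    congr 2
    push_cast
    field_simp
  refine ((h1.mul_left ((p : ℂ) ^ (k - 1))).add h2).congr_fun fun n ↦ ?_
  rw [heckeCoeff]
  ring

lemma IsBasisElt.coeff_of_nonpos {Γ : Subgroup SL(2, ℤ)} {m : ℤ} {f : WhmForm Γ k}
    (hf : IsBasisElt k 0 m f) {n : ℤ} (hn : n ≤ 0) :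
    f.coeff n = if n = -m then 1 else 0 := by
  split_ifs with h
  · rw [h, hf.1]
  · exact hf.2 n h hn

/-- The recursion for multiplication of the index by a single prime. -/
lemma coeff_mul_prime (hk : k < 12 ∨ k = 14) {a : ℤ → ℤ → ℤ} (ha : IsCoeffs k a)
    (p : ℕ) [hp : Fact p.Prime] {m n : ℤ} (hm : 0 < m) (hn : 0 < n) :
    (a m (n * p) : ℂ) =
      (p : ℂ) ^ (k - 1) * (a (m * p) n - (if (p : ℤ) ∣ n then a m (n / p) else 0 : ℤ)) +
        (if (p : ℤ) ∣ m then a (m / p) n else 0 : ℤ) := by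
  have hp0 : (0 : ℤ) < p := by exact_mod_cast hp.out.pos
  obtain ⟨f, hf0, hf⟩ := ha.1 m hm.le
  obtain ⟨g, hg0, hg⟩ := ha.1 (m * p) (by positivity)
  obtain ⟨h, hh0, hh⟩ := ha.1 (m / p) (Int.ediv_nonneg hm.le hp0.le)
  set ε : ℂ := if (p : ℤ) ∣ m then 1 else 0 with hε
  have hslash (F : WhmForm ⊤ k) (γ : SL(2, ℤ)) : F.toFun ∣[k] γ = F.toFun :=
    F.slash_eq γ (Subgroup.mem_top γ)
  have key := coeff_eq_zero_of_vanishing hk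
    (f := heckeOperator p k f.toFun - (p : ℂ) ^ (k - 1) • g.toFun - ε • h.toFun)
    (c := fun n ↦ heckeCoeff p k f.coeff n - (p : ℂ) ^ (k - 1) * g.coeff n - ε * h.coeff n)
    (((mdifferentiable_heckeOperator p f.holo).sub (g.holo.const_smul _)).sub
      (h.holo.const_smul _))
    (fun γ ↦ by
      simp only [sub_eq_add_neg, SlashAction.add_slash, SlashAction.neg_slash,
        ModularForm.SL_smul_slash, hslash, heckeOperator_slash p (hslash f)])
    (fun τ ↦ (((hasSum_heckeOperator p f.expansion.2 τ).sub
      ((g.expansion.2 τ).mul_left ((p : ℂ) ^ (k - 1)))).sub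
        ((h.expansion.2 τ).mul_left ε)).congr_fun fun n ↦ by ring)
    (fun n hn ↦ by
      have hnp : n / p ≤ 0 := Int.ediv_nonpos_of_nonpos_of_neg hn hp0
      rw [heckeCoeff, hf0.coeff_of_nonpos hnp,
        hf0.coeff_of_nonpos (mul_nonpos_of_nonpos_of_nonneg hn hp0.le), hg0.coeff_of_nonpos hn,
        hh0.coeff_of_nonpos hn, hε]
      have e1 : (if (p : ℤ) ∣ n then (if n / p = -m then 1 else 0) else 0 : ℂ) =
          if n = -(m * p) then 1 else 0 := by
        by_cases hpn : (p : ℤ) ∣ n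
        · obtain ⟨t, rfl⟩ := hpn
          have : p * t = -(m * p) ↔ t = -m := by
            rw [← neg_mul, mul_comm, mul_left_inj' hp0.ne']
          simp [this, Int.mul_ediv_cancel_left _ hp0.ne']
        · have : n ≠ -(m * p) := fun h ↦ hpn (h ▸ ⟨-m, by ring⟩)
          simp [hpn, this]
      have e2 : (if n * p = -m then 1 else 0 : ℂ) =
          (if (p : ℤ) ∣ m then 1 else 0) * (if n = -(m / p) then 1 else 0) := by
        by_cases hpm : (p : ℤ) ∣ m
        · obtain ⟨t, rfl⟩ := hpm
          have : n * p = -(p * t) ↔ n = -t := by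
            rw [← mul_neg, mul_comm, mul_right_inj' hp0.ne']
          simp [this, Int.mul_ediv_cancel_left _ hp0.ne']
        · have : n * p ≠ -m := fun h ↦ hpm ⟨-n, by linarith⟩
          simp [hpm, this]
      rw [e1, e2]
      ring)
    n
  have hdiv : (if (p : ℤ) ∣ n then f.coeff (n / p) else 0) =
      (if (p : ℤ) ∣ n then a m (n / p) else 0 : ℤ) := by
    split_ifs with hpn
    · exact hf _ (Int.ediv_pos_of_pos_of_dvd hn hp0.le hpn)
    · simp
  rw [heckeCoeff, hdiv, hf _ (mul_pos hn hp0), hg n hn, hh n hn, hε] at key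
  split_ifs at key ⊢ <;> push_cast <;> linear_combination key

lemma coeff_mul_prime_pow (hk : k < 12 ∨ k = 14) {a : ℤ → ℤ → ℤ} (ha : IsCoeffs k a)
    (p : ℕ) [hp : Fact p.Prime] {m n : ℤ} (hm : 0 < m) (hn : 0 < n) (s : ℕ) :
    (a m (n * p ^ (s + 1)) : ℂ) =
      ((p : ℂ) ^ (k - 1)) ^ (s + 1) * (a (m * p ^ (s + 1)) n -
        (if (p : ℤ) ∣ n then a (m * p ^ s) (n / p) else 0 : ℤ)) +
      (if (p : ℤ) ∣ m then a (m / p) (n * p ^ s) else 0 : ℤ) := by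
  have hp0 : (0 : ℤ) < p := by exact_mod_cast hp.out.pos
  induction s generalizing m with
  | zero => simpa using coeff_mul_prime hk ha p hm hn
  | succ s ih =>
    have h1 := coeff_mul_prime hk ha p hm (n := n * p ^ (s + 1)) (by positivity)
    have h2 := ih (m := m * p) (by positivity)
    have h3 : n * (p : ℤ) ^ (s + 1) / p = n * p ^ s := by
      rw [pow_succ, ← mul_assoc, Int.mul_ediv_cancel _ hp0.ne']
    rw [if_pos (dvd_mul_of_dvd_right (dvd_pow_self _ s.succ_ne_zero) _), h3] at h1
    rw [if_pos (dvd_mul_left _ _), Int.mul_ediv_cancel _ hp0.ne', mul_assoc m, mul_assoc m,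
      ← pow_succ', ← pow_succ'] at h2
    rw [pow_succ (p : ℤ) (s + 1), ← mul_assoc, h1, h2]
    simp only [pow_succ, mul_assoc]
    ring

end HeckeRecursion

/-- The recursion for the coefficients `a_k(m, n pˢ)`; terms with non-integral
arguments are zero. -/
theorem stmt_6 (p : ℕ) (hp : p.Prime) (k : ℕ) (hk : k ∈ ({4, 6, 8, 10, 14} : Set ℕ))
    (a : ℤ → ℤ → ℤ) (ha : IsCoeffs k a) (m n : ℤ) (s : ℕ)
    (hm : 0 < m) (hn : 0 < n) (hs : 0 < s) :
    a m (n * p ^ s) =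
      (p : ℤ) ^ (s * (k - 1)) *
        (a (m * p ^ s) n - (if (p : ℤ) ∣ n then a (m * p ^ (s - 1)) (n / p) else 0)) +
      (if (p : ℤ) ∣ m then a (m / p) (n * p ^ (s - 1)) else 0) := by
  have := Fact.mk hp
  obtain ⟨s, rfl⟩ := Nat.exists_eq_add_of_lt hs
  have hk' : (k : ℤ) < 12 ∨ (k : ℤ) = 14 := by
    rcases hk with rfl | rfl | rfl | rfl | rfl <;> norm_num
  have hk1 : ((k : ℤ) - 1) = (k - 1 : ℕ) := by
    rcases hk with rfl | rfl | rfl | rfl | rfl <;> norm_num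
  have := coeff_mul_prime_pow hk' ha p hm hn s
  rw [hk1, zpow_natCast, ← pow_mul, mul_comm (k - 1)] at this
  simp only [zero_add, Nat.add_sub_cancel]
  exact_mod_cast this
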